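/- arXiv:1402.4285 — 3 statements merged into one kernel-verified Lean document; each statement's English description precedes it below -/
import Mathlib

section
/- Let a, b, c > 0 be real numbers, s a complex number with Re(s) > 0, w ∈ ℂ, and set Ψ(s) := coth(as/c) + coth(bs/c). Suppose ψ : ℝ → ℂ is twice differentiable and satisfies c² ψ''(x) = s² ψ(x) for all x ∈ [−a, 0], together with ψ(−a) = 0 and ψ'(0) = (s/c)·Ψ(s)·w. Then ψ(x) = w·Ψ(s)·sinh((x+a)s/c)/cosh(as/c) for all x ∈ [−a, 0], and in particular ψ(0) = tanh(as/c)·(coth(as/c) + coth(bs/c))·w. -/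
open Complex

lemma Complex.cosh_ne_zero_of_re_pos {z : ℂ} (hz : 0 < z.re) : cosh z ≠ 0 := by
  intro h
  have h1 : exp z = -exp (-z) := by
    rw [← cosh_add_sinh, ← cosh_sub_sinh, h]
    ring
  have h2 := congrArg norm h1
  rw [norm_neg, norm_exp, norm_exp, Real.exp_eq_exp, neg_re] at h2
  linarith

lemma deriv_sub_mul_eq_of_deriv_deriv_eq {l r : ℝ} {k : ℂ} {f : ℝ → ℂ}
    (hf : Differentiable ℝ f) (hf' : Differentiable ℝ (deriv f))
    (hode : ∀ x ∈ Set.Icc l r, deriv (deriv f) x = k ^ 2 * f x) {x : ℝ}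
    (hx : x ∈ Set.Icc l r) :
    deriv f x - k * f x = (deriv f l - k * f l) * exp (-(k * (x - l))) := by
  have hderiv : ∀ y : ℝ, HasDerivAt (fun y : ℝ => (deriv f y - k * f y) * exp (k * (y - l)))
      ((deriv (deriv f) y - k * deriv f y) * exp (k * (y - l))
        + (deriv f y - k * f y) * (exp (k * (y - l)) * (k * 1))) y := fun y =>
    ((hf' y).hasDerivAt.sub ((hf y).hasDerivAt.const_mul k)).mul
      (((hasDerivAt_id y).ofReal_comp.sub_const (l : ℂ)).const_mul k).cexp
  have hconst := constant_of_has_deriv_right_zero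
    (fun y _ => (hderiv y).continuousAt.continuousWithinAt)
    (fun y hy => by
      have h := hderiv y
      rw [hode y (Set.Ico_subset_Icc_self hy)] at h
      convert h.hasDerivWithinAt using 1
      ring) x hx
  simp only [sub_self, mul_zero, exp_zero, mul_one] at hconst
  rw [← hconst, mul_assoc, ← exp_add, add_neg_cancel, exp_zero, mul_one]

lemma eq_sinh_and_deriv_eq_cosh_of_deriv_deriv_eq {l r : ℝ} {k : ℂ} {f : ℝ → ℂ}
    (hf : Differentiable ℝ f) (hf' : Differentiable ℝ (deriv f))
    (hode : ∀ x ∈ Set.Icc l r, deriv (deriv f) x = k ^ 2 * f x) (hl : f l = 0) {x : ℝ}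
    (hx : x ∈ Set.Icc l r) :
    k * f x = deriv f l * sinh (k * (x - l)) ∧ deriv f x = deriv f l * cosh (k * (x - l)) := by
  have h1 := deriv_sub_mul_eq_of_deriv_deriv_eq hf hf' hode hx
  have h2 := deriv_sub_mul_eq_of_deriv_deriv_eq (k := -k) hf hf' (by simpa using hode) hx
  rw [hl, ← cosh_sub_sinh] at h1
  rw [hl, neg_mul k ((x : ℂ) - l), neg_neg, ← cosh_add_sinh] at h2
  constructor
  · linear_combination (h2 - h1) / 2
  · linear_combination (h1 + h2) / 2

/-- Laplace-transformed auxiliary (Neumann-correction) subdomain problem of NNWR on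
`(-a, 0)`: with `Ψ(s) = coth(as/c) + coth(bs/c)` (`coth z = cosh z / sinh z`), if `ψ`
is twice differentiable, satisfies `c² ψ'' = s² ψ` on `[-a, 0]`, and `ψ(-a) = 0`,
`ψ'(0) = (s/c)·Ψ(s)·w`, then `ψ(x) = w·Ψ(s)·sinh((x+a)s/c)/cosh(as/c)` on `[-a, 0]`
and `ψ(0) = tanh(as/c)·(coth(as/c) + coth(bs/c))·w`. -/
theorem NNWR_correction_subdomain (a b c : ℝ) (ha : 0 < a) (hb : 0 < b) (hc : 0 < c)
    (s : ℂ) (hs : 0 < s.re) (w : ℂ) (ψ : ℝ → ℂ)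
    (hu1 : Differentiable ℝ ψ) (hu2 : Differentiable ℝ (deriv ψ))
    (hode : ∀ x ∈ Set.Icc (-a) 0, (c : ℂ) ^ 2 * deriv (deriv ψ) x = s ^ 2 * ψ x)
    (hbc1 : ψ (-a) = 0)
    (hbc2 : deriv ψ 0 = s / c * (cosh ((a : ℂ) * s / c) / sinh ((a : ℂ) * s / c)
      + cosh ((b : ℂ) * s / c) / sinh ((b : ℂ) * s / c)) * w) :
    (∀ x ∈ Set.Icc (-a) 0,
      ψ x = w * (cosh ((a : ℂ) * s / c) / sinh ((a : ℂ) * s / c)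
          + cosh ((b : ℂ) * s / c) / sinh ((b : ℂ) * s / c))
        * sinh (((x : ℂ) + a) * s / c) / cosh ((a : ℂ) * s / c)) ∧
    ψ 0 = tanh ((a : ℂ) * s / c) * (cosh ((a : ℂ) * s / c) / sinh ((a : ℂ) * s / c)
      + cosh ((b : ℂ) * s / c) / sinh ((b : ℂ) * s / c)) * w := by
  have hc' : (c : ℂ) ≠ 0 := ofReal_ne_zero.mpr hc.ne'
  have hs' : s ≠ 0 := by
    rintro rfl
    simp at hs
  have hcosh : cosh ((a : ℂ) * s / c) ≠ 0 := by
    apply cosh_ne_zero_of_re_pos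
    rw [div_ofReal_re, re_ofReal_mul]
    positivity
  have hode' : ∀ x ∈ Set.Icc (-a) 0, deriv (deriv ψ) x = (s / c) ^ 2 * ψ x := by
    intro x hx
    have h := hode x hx
    field_simp
    linear_combination h
  have h0 : (0 : ℝ) ∈ Set.Icc (-a) 0 := ⟨by linarith, le_rfl⟩
  generalize cosh ((a : ℂ) * s / c) / sinh ((a : ℂ) * s / c)
    + cosh ((b : ℂ) * s / c) / sinh ((b : ℂ) * s / c) = Ψ at *
  have hD := (eq_sinh_and_deriv_eq_cosh_of_deriv_deriv_eq hu1 hu2 hode' hbc1 h0).2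
  rw [hbc2, show s / c * (((0 : ℝ) : ℂ) - ((-a : ℝ) : ℂ)) = a * s / c by push_cast; ring] at hD
  have hmain : ∀ x ∈ Set.Icc (-a) 0,
      ψ x = w * Ψ * sinh (((x : ℂ) + a) * s / c) / cosh ((a : ℂ) * s / c) := by
    intro x hx
    have h := (eq_sinh_and_deriv_eq_cosh_of_deriv_deriv_eq hu1 hu2 hode' hbc1 hx).1
    rw [show s / c * ((x : ℂ) - ((-a : ℝ) : ℂ)) = (x + a) * s / c by push_cast; ring] at h
    rw [eq_div_iff hcosh]
    apply mul_left_cancel₀ (div_ne_zero hs' hc')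
    linear_combination cosh ((a : ℂ) * s / c) * h - sinh (((x : ℂ) + a) * s / c) * hD
  refine ⟨hmain, ?_⟩
  rw [hmain 0 h0, ofReal_zero, zero_add, tanh_eq_sinh_div_cosh]
  ring
end

section
/- Let a, b, c > 0 be real numbers, σ > 0, and let (ĥ^k)_{k≥0} be complex-valued functions on the half-plane {Re(s) ≥ σ} satisfying, for each k ≥ 0 and each s with Re(s) ≥ σ, ĥ^k(s) = (−1/2)^k·(coth(as/c)·tanh(bs/c) − 1)^k·ĥ^0(s). Then there exists a constant C > 0 such that for all k ≥ 0 and all s with Re(s) ≥ σ, |ĥ^k(s)| ≤ (C/2)^k·e^{−2k·min(a,b)·Re(s)/c}·|ĥ^0(s)|. -/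
open Complex

theorem norm_exp_neg_two_mul (z : ℂ) : ‖exp (-2 * z)‖ = Real.exp (-2 * z.re) := by
  simp [norm_exp]

theorem one_sub_exp_neg_two_mul_ne_zero {z : ℂ} (hz : 0 < z.re) : 1 - exp (-2 * z) ≠ 0 := by
  intro h
  have h' := norm_exp_neg_two_mul z
  rw [← sub_eq_zero.mp h, norm_one] at h'
  linarith [Real.exp_lt_one_iff.mpr (show -2 * z.re < 0 by linarith)]

theorem one_add_exp_neg_two_mul_ne_zero {w : ℂ} (hw : 0 < w.re) : 1 + exp (-2 * w) ≠ 0 := by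
  intro h
  have h' := norm_exp_neg_two_mul w
  rw [eq_neg_of_add_eq_zero_right h, norm_neg, norm_one] at h'
  linarith [Real.exp_lt_one_iff.mpr (show -2 * w.re < 0 by linarith)]

theorem cosh_eq_exp_mul (z : ℂ) : cosh z = exp z * (1 + exp (-2 * z)) / 2 := by
  rw [cosh, mul_add, ← exp_add]
  ring_nf

theorem sinh_eq_exp_mul (z : ℂ) : sinh z = exp z * (1 - exp (-2 * z)) / 2 := by
  rw [sinh, mul_sub, ← exp_add]
  ring_nf

theorem coth_mul_tanh_sub_one {z w : ℂ} (hz : 0 < z.re) (hw : 0 < w.re) :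
    cosh z / sinh z * tanh w - 1 =
      2 * (exp (-2 * z) - exp (-2 * w)) / ((1 - exp (-2 * z)) * (1 + exp (-2 * w))) := by
  have h₁ := one_sub_exp_neg_two_mul_ne_zero hz
  have h₂ := one_add_exp_neg_two_mul_ne_zero hw
  have h₃ := exp_ne_zero z
  have h₄ := exp_ne_zero w
  rw [tanh_eq_sinh_div_cosh, cosh_eq_exp_mul z, sinh_eq_exp_mul z, cosh_eq_exp_mul w,
    sinh_eq_exp_mul w]
  generalize exp (-2 * z) = u at *
  generalize exp (-2 * w) = v at *
  field_simp
  ring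

theorem norm_coth_mul_tanh_sub_one_le {z w : ℂ} {α β m : ℝ} (hα : 0 < α) (hβ : 0 < β)
    (hz : α ≤ z.re) (hw : β ≤ w.re) (hmz : m ≤ z.re) (hmw : m ≤ w.re) :
    ‖cosh z / sinh z * tanh w - 1‖ ≤
      4 / ((1 - Real.exp (-2 * α)) * (1 - Real.exp (-2 * β))) * Real.exp (-2 * m) := by
  have hα₁ : 0 < 1 - Real.exp (-2 * α) := sub_pos.mpr (Real.exp_lt_one_iff.mpr (by linarith))
  have hβ₁ : 0 < 1 - Real.exp (-2 * β) := sub_pos.mpr (Real.exp_lt_one_iff.mpr (by linarith))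
  have hnum : ‖exp (-2 * z) - exp (-2 * w)‖ ≤ 2 * Real.exp (-2 * m) := by
    have h := norm_sub_le (exp (-2 * z)) (exp (-2 * w))
    rw [norm_exp_neg_two_mul, norm_exp_neg_two_mul] at h
    have h₁ : Real.exp (-2 * z.re) ≤ Real.exp (-2 * m) := Real.exp_le_exp.mpr (by linarith)
    have h₂ : Real.exp (-2 * w.re) ≤ Real.exp (-2 * m) := Real.exp_le_exp.mpr (by linarith)
    linarith
  have hden₁ : 1 - Real.exp (-2 * α) ≤ ‖1 - exp (-2 * z)‖ := by
    have h := norm_sub_norm_le 1 (exp (-2 * z))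
    rw [norm_exp_neg_two_mul, norm_one] at h
    have h₁ : Real.exp (-2 * z.re) ≤ Real.exp (-2 * α) := Real.exp_le_exp.mpr (by linarith)
    linarith
  have hden₂ : 1 - Real.exp (-2 * β) ≤ ‖1 + exp (-2 * w)‖ := by
    have h := norm_sub_norm_le 1 (-exp (-2 * w))
    rw [norm_neg, norm_exp_neg_two_mul, norm_one, sub_neg_eq_add] at h
    have h₁ : Real.exp (-2 * w.re) ≤ Real.exp (-2 * β) := Real.exp_le_exp.mpr (by linarith)
    linarith
  rw [coth_mul_tanh_sub_one (hα.trans_le hz) (hβ.trans_le hw), norm_div, norm_mul, norm_mul,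
    Complex.norm_two]
  calc 2 * ‖exp (-2 * z) - exp (-2 * w)‖ / (‖1 - exp (-2 * z)‖ * ‖1 + exp (-2 * w)‖)
      ≤ 2 * (2 * Real.exp (-2 * m)) /
          ((1 - Real.exp (-2 * α)) * (1 - Real.exp (-2 * β))) := by gcongr
    _ = _ := by ring

/-- Quantitative core of the DNWR finite-step convergence theorem (θ = 1/2): if
`ĥ^k(s) = (−1/2)^k·G_b^a(s)^k·ĥ^0(s)` on `Re s ≥ σ`, with
`G_b^a(s) = coth(as/c)·tanh(bs/c) − 1` and `coth z = cosh z / sinh z`, then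
`|ĥ^k(s)| ≤ (C/2)^k·e^{−2k·min(a,b)·Re(s)/c}·|ĥ^0(s)|` for some `C > 0`. -/
theorem DNWR_iterate_decay (a b c σ : ℝ) (ha : 0 < a) (hb : 0 < b) (hc : 0 < c)
    (hσ : 0 < σ) (hh : ℕ → ℂ → ℂ)
    (hiter : ∀ k : ℕ, ∀ s : ℂ, σ ≤ s.re → hh k s =
      (-1 / 2 : ℂ) ^ k *
        (cosh ((a : ℂ) * s / c) / sinh ((a : ℂ) * s / c) * tanh ((b : ℂ) * s / c) - 1) ^ k *
        hh 0 s) :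
    ∃ C : ℝ, 0 < C ∧ ∀ k : ℕ, ∀ s : ℂ, σ ≤ s.re →
      ‖hh k s‖ ≤ (C / 2) ^ k * Real.exp (-2 * k * min a b * s.re / c) * ‖hh 0 s‖ := by
  have hα : 0 < a * σ / c := by positivity
  have hβ : 0 < b * σ / c := by positivity
  have hα₁ : 0 < 1 - Real.exp (-2 * (a * σ / c)) :=
    sub_pos.mpr (Real.exp_lt_one_iff.mpr (by linarith))
  have hβ₁ : 0 < 1 - Real.exp (-2 * (b * σ / c)) :=
    sub_pos.mpr (Real.exp_lt_one_iff.mpr (by linarith))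
  refine ⟨4 / ((1 - Real.exp (-2 * (a * σ / c))) * (1 - Real.exp (-2 * (b * σ / c)))),
    by positivity, fun k s hs => ?_⟩
  have hs₀ : 0 < s.re := hσ.trans_le hs
  have hre (x : ℝ) : ((x : ℂ) * s / c).re = x * s.re / c := by
    rw [div_ofReal_re, re_ofReal_mul]
  have hG := norm_coth_mul_tanh_sub_one_le (z := (a : ℂ) * s / c) (w := (b : ℂ) * s / c)
    (m := min a b * s.re / c) hα hβ (by rw [hre]; gcongr) (by rw [hre]; gcongr)
    (by rw [hre]; gcongr; exact min_le_left a b) (by rw [hre]; gcongr; exact min_le_right a b)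
  have hexp : Real.exp (-2 * k * min a b * s.re / c) =
      Real.exp (-2 * (min a b * s.re / c)) ^ k := by
    rw [← Real.exp_nat_mul]
    ring_nf
  have hhalf : ‖(-1 / 2 : ℂ)‖ = 1 / 2 := by norm_num
  rw [hiter k s hs, norm_mul, norm_mul, norm_pow, norm_pow, hhalf, hexp, ← mul_pow, ← mul_pow]
  refine mul_le_mul_of_nonneg_right (pow_le_pow_left₀ (by positivity) ?_ k) (norm_nonneg _)
  linarith
end

section
/- Let a, b, c > 0 be real numbers, σ > 0, and let (ŵ^k)_{k≥0} be complex-valued functions on the half-plane {Re(s) ≥ σ} satisfying, for each k ≥ 0 and each s with Re(s) ≥ σ, ŵ^k(s) = (−1/4)^k·[(coth(as/c)·tanh(bs/c) − 1) + (coth(bs/c)·tanh(as/c) − 1)]^k·ŵ^0(s). Then there exists a constant C > 0 such that for all k ≥ 0 and all s with Re(s) ≥ σ, |ŵ^k(s)| ≤ (C/4)^k·e^{−4k·min(a,b)·Re(s)/c}·|ŵ^0(s)|. -/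
open Complex

theorem norm_sinh_le_exp_abs_re (z : ℂ) : ‖sinh z‖ ≤ Real.exp |z.re| := by
  have h : ‖exp z - exp (-z)‖ ≤ Real.exp z.re + Real.exp (-z.re) := by
    simpa [norm_exp] using norm_sub_le (exp z) (exp (-z))
  have h₁ := Real.exp_le_exp.2 (le_abs_self z.re)
  have h₂ := Real.exp_le_exp.2 (neg_le_abs z.re)
  rw [sinh, norm_div, Complex.norm_ofNat]
  linarith

theorem mul_exp_re_le_norm_sinh {d : ℝ} {z : ℂ} (hz : d ≤ z.re) :
    (1 - Real.exp (-2 * d)) / 2 * Real.exp z.re ≤ ‖sinh z‖ := by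
  have h : Real.exp z.re - Real.exp (-z.re) ≤ ‖exp z - exp (-z)‖ := by
    simpa [norm_exp] using norm_sub_norm_le (exp z) (exp (-z))
  have h₁ : Real.exp (-z.re) ≤ Real.exp (-2 * d) * Real.exp z.re := by
    rw [← Real.exp_add]
    exact Real.exp_le_exp.2 (by linarith)
  rw [sinh, norm_div, Complex.norm_ofNat]
  linarith

theorem coth_mul_tanh_sub_one_add_eq {x y : ℂ} (hx : sinh (2 * x) ≠ 0) (hy : sinh (2 * y) ≠ 0) :
    (cosh x / sinh x * tanh y - 1) + (cosh y / sinh y * tanh x - 1) =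
      4 * sinh (x - y) ^ 2 / (sinh (2 * x) * sinh (2 * y)) := by
  rw [sinh_two_mul] at *
  rw [sinh_two_mul] at *
  simp only [ne_eq, mul_eq_zero, OfNat.ofNat_ne_zero, false_or, not_or] at hx hy
  obtain ⟨hsx, hcx⟩ := hx
  obtain ⟨hsy, hcy⟩ := hy
  rw [tanh_eq_sinh_div_cosh, tanh_eq_sinh_div_cosh, sinh_sub]
  field_simp
  ring

theorem norm_coth_mul_tanh_sub_one_add_le {d e : ℝ} (hd : 0 < d) (he : 0 < e) {x y : ℂ}
    (hx : d ≤ x.re) (hy : e ≤ y.re) :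
    ‖(cosh x / sinh x * tanh y - 1) + (cosh y / sinh y * tanh x - 1)‖ ≤
      4 / ((1 - Real.exp (-4 * d)) / 2 * ((1 - Real.exp (-4 * e)) / 2)) *
        Real.exp (-4 * min x.re y.re) := by
  have key {d : ℝ} (hd : 0 < d) {x : ℂ} (hx : d ≤ x.re) :
      0 < (1 - Real.exp (-4 * d)) / 2 ∧
        (1 - Real.exp (-4 * d)) / 2 * Real.exp (2 * x.re) ≤ ‖sinh (2 * x)‖ := by
    constructor
    · linarith [Real.exp_lt_one_iff.2 (show -4 * d < 0 by linarith)]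
    · have h := mul_exp_re_le_norm_sinh (d := 2 * d) (z := 2 * x) (by simpa using hx)
      rw [show -2 * (2 * d) = -4 * d by ring] at h
      simpa using h
  obtain ⟨hK, hKx⟩ := key hd hx
  obtain ⟨hL, hLy⟩ := key he hy
  set K := (1 - Real.exp (-4 * d)) / 2
  set L := (1 - Real.exp (-4 * e)) / 2
  have hsx : 0 < ‖sinh (2 * x)‖ := lt_of_lt_of_le (by positivity) hKx
  have hsy : 0 < ‖sinh (2 * y)‖ := lt_of_lt_of_le (by positivity) hLy
  rw [coth_mul_tanh_sub_one_add_eq (norm_pos_iff.1 hsx) (norm_pos_iff.1 hsy), norm_div, norm_mul,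
    norm_mul, norm_pow, Complex.norm_ofNat]
  have hmin : -4 * min x.re y.re = 2 * |x.re - y.re| - 2 * x.re - 2 * y.re := by
    rcases le_total x.re y.re with h | h
    · rw [min_eq_left h, abs_of_nonpos (by linarith)]
      ring
    · rw [min_eq_right h, abs_of_nonneg (by linarith)]
      ring
  calc 4 * ‖sinh (x - y)‖ ^ 2 / (‖sinh (2 * x)‖ * ‖sinh (2 * y)‖)
      ≤ 4 * Real.exp |x.re - y.re| ^ 2 /
          (K * Real.exp (2 * x.re) * (L * Real.exp (2 * y.re))) := by
        gcongr
        simpa using norm_sinh_le_exp_abs_re (x - y)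
    _ = 4 / (K * L) * Real.exp (-4 * min x.re y.re) := by
        rw [hmin, Real.exp_sub, Real.exp_sub, ← Real.exp_nat_mul]
        push_cast
        field_simp

/-- Quantitative core of the NNWR finite-step convergence theorem (θ = 1/4): if
`ŵ^k(s) = (−1/4)^k·(G_b^a(s) + G_a^b(s))^k·ŵ^0(s)` on `Re s ≥ σ`, with
`G_b^a(s) = coth(as/c)·tanh(bs/c) − 1` and `coth z = cosh z / sinh z`, then
`|ŵ^k(s)| ≤ (C/4)^k·e^{−4k·min(a,b)·Re(s)/c}·|ŵ^0(s)|` for some `C > 0`. -/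
theorem NNWR_iterate_decay (a b c σ : ℝ) (ha : 0 < a) (hb : 0 < b) (hc : 0 < c)
    (hσ : 0 < σ) (ww : ℕ → ℂ → ℂ)
    (hiter : ∀ k : ℕ, ∀ s : ℂ, σ ≤ s.re → ww k s =
      (-1 / 4 : ℂ) ^ k *
        ((cosh ((a : ℂ) * s / c) / sinh ((a : ℂ) * s / c) * tanh ((b : ℂ) * s / c) - 1)
          + (cosh ((b : ℂ) * s / c) / sinh ((b : ℂ) * s / c) * tanh ((a : ℂ) * s / c) - 1)) ^ k *
        ww 0 s) :
    ∃ C : ℝ, 0 < C ∧ ∀ k : ℕ, ∀ s : ℂ, σ ≤ s.re →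
      ‖ww k s‖ ≤ (C / 4) ^ k * Real.exp (-4 * k * min a b * s.re / c) * ‖ww 0 s‖ := by
  have hre (r : ℝ) (s : ℂ) : ((r : ℂ) * s / c).re = r * s.re / c := by
    rw [div_ofReal_re, re_ofReal_mul]
  have hda : 0 < a * σ / c := by positivity
  have hdb : 0 < b * σ / c := by positivity
  have hKa := Real.exp_lt_one_iff.2 (show -4 * (a * σ / c) < 0 by linarith)
  have hKb := Real.exp_lt_one_iff.2 (show -4 * (b * σ / c) < 0 by linarith)
  refine ⟨4 / ((1 - Real.exp (-4 * (a * σ / c))) / 2 * ((1 - Real.exp (-4 * (b * σ / c))) / 2)),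
    div_pos four_pos (mul_pos (by linarith) (by linarith)), fun k s hs => ?_⟩
  have hG := norm_coth_mul_tanh_sub_one_add_le hda hdb (x := (a : ℂ) * s / c)
    (y := (b : ℂ) * s / c) (by rw [hre]; gcongr) (by rw [hre]; gcongr)
  have hmin : min (a * s.re / c) (b * s.re / c) = min a b * s.re / c := by
    rw [min_div_div_right hc.le, ← min_mul_of_nonneg _ _ (hσ.le.trans hs)]
  rw [hre, hre, hmin] at hG
  rw [hiter k s hs, norm_mul, norm_mul, norm_pow, norm_pow,
    show -4 * (k : ℝ) * min a b * s.re / c = k * (-4 * (min a b * s.re / c)) by ring,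
    Real.exp_nat_mul, ← mul_pow, ← mul_pow]
  have hquarter : ‖(-1 / 4 : ℂ)‖ = 1 / 4 := by norm_num
  rw [hquarter]
  refine mul_le_mul_of_nonneg_right (pow_le_pow_left₀ (by positivity) ?_ k) (norm_nonneg _)
  linarith
end
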